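/- arXiv:2005.03062 — 2 statements merged into one kernel-verified Lean document; each statement's English description precedes it below -/
import Mathlib

section
/- Let (g, b, I, J) be bihermitian data defining a generalized Kähler structure via the Gualtieri map J_{1/2} = (1/2) e^b [[I±J, -(ω_I^{-1} ∓ ω_J^{-1})],[ω_I ∓ ω_J, -(I*±J*)]] e^{-b}. For a 2-form K, the equality of commutators [Φ_K(J_1), J_2] = [Φ_K(J_2), J_1] holds if and only if K J = -J* K, i.e. K ∈ Λ^{1,1}_J. -/
/-- Block endomorphism `[[A, B], [C, D]]` of `T ⊕ T*`. -/
noncomputable def blk {T : Type*} [AddCommGroup T] [Module ℝ T]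
    (A : T →ₗ[ℝ] T) (B : Module.Dual ℝ T →ₗ[ℝ] T)
    (C : T →ₗ[ℝ] Module.Dual ℝ T)
    (D : Module.Dual ℝ T →ₗ[ℝ] Module.Dual ℝ T) :
    Module.End ℝ (T × Module.Dual ℝ T) :=
  LinearMap.prod
    (A ∘ₗ LinearMap.fst ℝ T (Module.Dual ℝ T) + B ∘ₗ LinearMap.snd ℝ T (Module.Dual ℝ T))
    (C ∘ₗ LinearMap.fst ℝ T (Module.Dual ℝ T) + D ∘ₗ LinearMap.snd ℝ T (Module.Dual ℝ T))

section Ring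

variable {R : Type*} [Ring R]

/-- For commuting complex structures `A`, `B` the commutator identity for `Φ` only involves
`A - B`. -/
theorem commutator_phi_eq_iff [Algebra ℝ R] {A B N : R} (hA : A * A = -1) (hB : B * B = -1)
    (hAB : A * B = B * A) :
    ((A * ((1 + N) * A) - (1 + N) * A * A) * B - B * (A * ((1 + N) * A) - (1 + N) * A * A) =
      (B * ((1 + N) * B) - (1 + N) * B * B) * A - A * (B * ((1 + N) * B) - (1 + N) * B * B)) ↔
    (A - B) * N * ((A - B) * (A - B)) = (A - B) * (A - B) * N * (A - B) := by
  have phi : ∀ X : R, X * X = -1 → X * ((1 + N) * X) - (1 + N) * X * X = X * N * X + N := by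
    intro X hX
    rw [mul_assoc (1 + N), hX, add_mul, one_mul, mul_add, hX]
    noncomm_ring
  have sq : (A - B) * (A - B) = (-2 : ℝ) • (1 + A * B) := by
    rw [sub_mul, mul_sub, mul_sub, hA, hB, ← hAB]
    module
  have key : (A * N * A + N) * B - B * (A * N * A + N) -
      ((B * N * B + N) * A - A * (B * N * B + N)) =
      (A - B) * N * (1 + A * B) - (1 + A * B) * N * (A - B) := by
    have h₁ : B * (A * N * A) = A * B * N * A := by rw [hAB]; noncomm_ring
    have h₂ : B * N * B * A = B * N * (A * B) := by rw [hAB]; noncomm_ring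
    rw [mul_add B, h₁, add_mul _ _ A, h₂]
    noncomm_ring
  rw [phi A hA, phi B hB, ← sub_eq_zero, key, sub_eq_zero, sq]
  simp only [mul_smul_comm, smul_mul_assoc]
  exact (smul_right_injective R (by norm_num : (-2 : ℝ) ≠ 0)).eq_iff.symm

theorem conj_mul_conj {u v : R} (hvu : v * u = 1) (X Y : R) :
    u * X * v * (u * Y * v) = u * (X * Y) * v := by
  calc u * X * v * (u * Y * v) = u * X * (v * u) * Y * v := by noncomm_ring
    _ = u * (X * Y) * v := by rw [hvu]; noncomm_ring

theorem conj_injective_of_mul_eq_one {u v : R} (hvu : v * u = 1) :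
    Function.Injective fun X : R => u * X * v := by
  intro X Y h
  have hconj : v * (u * X * v) * u = v * (u * Y * v) * u := congrArg (fun Z => v * Z * u) h
  have e : ∀ Z : R, v * (u * Z * v) * u = Z := fun Z => by
    calc v * (u * Z * v) * u = v * u * Z * (v * u) := by noncomm_ring
      _ = Z := by rw [hvu, one_mul, mul_one]
  rwa [e, e] at hconj

/-- The commutator identity for a pair `(S ± D) / 2` conjugated by an element commuting
with `N`. -/
theorem commutator_phi_conj_eq_iff [Algebra ℝ R] {S D N u v : R}
    (huv : u * v = 1) (hvu : v * u = 1) (hN : u * N * v = N)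
    (hSD : S * D = 0) (hDS : D * S = 0) (hsq : S * S + D * D = (-4 : ℝ) • 1) {A B : R}
    (hA : A = u * ((1 / 2 : ℝ) • (S + D)) * v) (hB : B = u * ((1 / 2 : ℝ) • (S - D)) * v) :
    ((A * ((1 + N) * A) - (1 + N) * A * A) * B - B * (A * ((1 + N) * A) - (1 + N) * A * A) =
      (B * ((1 + N) * B) - (1 + N) * B * B) * A - A * (B * ((1 + N) * B) - (1 + N) * B * B)) ↔
    D * N * (D * D) = D * D * N * D := by
  have hAB : A - B = u * D * v := by
    rw [hA, hB, ← sub_mul, ← mul_sub, ← smul_sub]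
    congr 2
    module
  have hSS : S * S = (-4 : ℝ) • 1 - D * D := eq_sub_of_add_eq hsq
  have neg_one : u * (-1) * v = -1 := by rw [mul_neg_one, neg_mul, huv]
  have hAA : A * A = -1 := by
    rw [hA, conj_mul_conj hvu, ← neg_one]
    congr 2
    simp only [smul_mul_assoc, mul_smul_comm, add_mul, mul_add, hSD, hDS, hSS]
    module
  have hBB : B * B = -1 := by
    rw [hB, conj_mul_conj hvu, ← neg_one]
    congr 2
    simp only [smul_mul_assoc, mul_smul_comm, sub_mul, mul_sub, hSD, hDS, hSS]
    module
  have comm : A * B = B * A := by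
    rw [hA, hB, conj_mul_conj hvu, conj_mul_conj hvu]
    congr 2
    simp only [smul_mul_assoc, mul_smul_comm, sub_mul, mul_sub, add_mul, mul_add, hSD, hDS]
    module
  rw [commutator_phi_eq_iff hAA hBB comm, hAB]
  conv_lhs => rw [← hN]
  simp only [conj_mul_conj hvu]
  exact (conj_injective_of_mul_eq_one hvu).eq_iff

end Ring

section Block

variable {T : Type*} [AddCommGroup T] [Module ℝ T]

theorem blk_apply (A : T →ₗ[ℝ] T) (B : Module.Dual ℝ T →ₗ[ℝ] T) (C : T →ₗ[ℝ] Module.Dual ℝ T)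
    (D : Module.Dual ℝ T →ₗ[ℝ] Module.Dual ℝ T) (p : T × Module.Dual ℝ T) :
    blk A B C D p = (A p.1 + B p.2, C p.1 + D p.2) :=
  rfl

theorem blk_mul (A A' : T →ₗ[ℝ] T) (B B' : Module.Dual ℝ T →ₗ[ℝ] T)
    (C C' : T →ₗ[ℝ] Module.Dual ℝ T) (D D' : Module.Dual ℝ T →ₗ[ℝ] Module.Dual ℝ T) :
    blk A B C D * blk A' B' C' D' =
      blk (A ∘ₗ A' + B ∘ₗ C') (A ∘ₗ B' + B ∘ₗ D') (C ∘ₗ A' + D ∘ₗ C') (C ∘ₗ B' + D ∘ₗ D') := by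
  refine LinearMap.ext fun p => ?_
  simp only [Module.End.mul_apply, blk_apply, map_add, LinearMap.add_apply,
    LinearMap.comp_apply, Prod.mk.injEq]
  constructor <;> abel

theorem blk_inj {A A' : T →ₗ[ℝ] T} {B B' : Module.Dual ℝ T →ₗ[ℝ] T}
    {C C' : T →ₗ[ℝ] Module.Dual ℝ T} {D D' : Module.Dual ℝ T →ₗ[ℝ] Module.Dual ℝ T} :
    blk A B C D = blk A' B' C' D' ↔ A = A' ∧ B = B' ∧ C = C' ∧ D = D' := by
  refine ⟨fun h => ?_, by rintro ⟨rfl, rfl, rfl, rfl⟩; rfl⟩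
  have hx := fun x : T => LinearMap.congr_fun h (x, 0)
  have hy := fun y : Module.Dual ℝ T => LinearMap.congr_fun h (0, y)
  simp only [blk_apply, map_zero, add_zero, zero_add, Prod.mk.injEq] at hx hy
  exact ⟨LinearMap.ext fun x => (hx x).1, LinearMap.ext fun y => (hy y).1,
    LinearMap.ext fun x => (hx x).2, LinearMap.ext fun y => (hy y).2⟩

theorem blk_one_lower (K : T →ₗ[ℝ] Module.Dual ℝ T) :
    blk LinearMap.id 0 K LinearMap.id = 1 + blk 0 0 K 0 := by
  refine LinearMap.ext fun p => ?_
  simp [blk_apply, Prod.ext_iff, add_comm]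

theorem blk_unipotent_mul_neg (b : T →ₗ[ℝ] Module.Dual ℝ T) :
    blk LinearMap.id 0 b LinearMap.id * blk LinearMap.id 0 (-b) LinearMap.id = 1 := by
  refine LinearMap.ext fun p => ?_
  simp [blk_apply]

/-- A complex structure `I` orthogonal for `g` satisfies `I* = -g I g⁻¹`. -/
theorem dualMap_eq_of_compatible {g : T →ₗ[ℝ] Module.Dual ℝ T} {G : Module.Dual ℝ T →ₗ[ℝ] T}
    {I : Module.End ℝ T} (hI : ∀ x, I (I x) = -x) (hgG : ∀ y, g (G y) = y)
    (hIg : I.dualMap ∘ₗ g ∘ₗ (I : T →ₗ[ℝ] T) = g) (y : Module.Dual ℝ T) :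
    I.dualMap y = -g (I (G y)) := by
  have h := LinearMap.congr_fun hIg (I (G y))
  simp only [LinearMap.comp_apply, hI, map_neg, hgG] at h
  rw [← h, neg_neg]

end Block

/-- For a generalized Kähler structure given by bihermitian data `(g, b, I, J)` via
the Gualtieri map, `[Φ_K(𝐉₁), 𝐉₂] = [Φ_K(𝐉₂), 𝐉₁]` iff `KJ = -J*K`, i.e. `K ∈ Λ^{1,1}_J`. -/
theorem stmt6 (T : Type*) [AddCommGroup T] [Module ℝ T] [FiniteDimensional ℝ T]
    (g K b : T →ₗ[ℝ] Module.Dual ℝ T) (I J : Module.End ℝ T)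
    (wIi wJi : Module.Dual ℝ T →ₗ[ℝ] T)
    (hI : I * I = -1) (hJ : J * J = -1)
    (hgsymm : ∀ x y : T, g x y = g y x)
    (hgpos : ∀ x : T, x ≠ 0 → 0 < g x x)
    (hIg : I.dualMap ∘ₗ g ∘ₗ (I : T →ₗ[ℝ] T) = g)
    (hJg : J.dualMap ∘ₗ g ∘ₗ (J : T →ₗ[ℝ] T) = g)
    (hbskew : ∀ x y : T, b x y = - b y x)
    (hKskew : ∀ x y : T, K x y = - K y x)
    (hwIi1 : (g ∘ₗ (I : T →ₗ[ℝ] T)) ∘ₗ wIi = LinearMap.id)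
    (hwIi2 : wIi ∘ₗ (g ∘ₗ (I : T →ₗ[ℝ] T)) = LinearMap.id)
    (hwJi1 : (g ∘ₗ (J : T →ₗ[ℝ] T)) ∘ₗ wJi = LinearMap.id)
    (hwJi2 : wJi ∘ₗ (g ∘ₗ (J : T →ₗ[ℝ] T)) = LinearMap.id) :
    let eK := blk LinearMap.id 0 K LinearMap.id
    let eB := blk LinearMap.id 0 b LinearMap.id
    let eBi := blk LinearMap.id 0 (-b) LinearMap.id
    let J1 := eB * ((1/2 : ℝ) • blk ((I : T →ₗ[ℝ] T) + (J : T →ₗ[ℝ] T)) (-(wIi - wJi))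
        (g ∘ₗ (I : T →ₗ[ℝ] T) - g ∘ₗ (J : T →ₗ[ℝ] T)) (-(I.dualMap + J.dualMap))) * eBi
    let J2 := eB * ((1/2 : ℝ) • blk ((I : T →ₗ[ℝ] T) - (J : T →ₗ[ℝ] T)) (-(wIi + wJi))
        (g ∘ₗ (I : T →ₗ[ℝ] T) + g ∘ₗ (J : T →ₗ[ℝ] T)) (-(I.dualMap - J.dualMap))) * eBi
    let Phi := fun A : Module.End ℝ (T × Module.Dual ℝ T) => A * (eK * A) - (eK * A) * A
    (Phi J1 * J2 - J2 * Phi J1 = Phi J2 * J1 - J1 * Phi J2)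
      ↔ K ∘ₗ (J : T →ₗ[ℝ] T) = -(J.dualMap ∘ₗ K) := by
  intro eK eB eBi J1 J2 Phi
  have hII : ∀ x, I (I x) = -x := fun x => LinearMap.congr_fun hI x
  have hJJ : ∀ x, J (J x) = -x := fun x => LinearMap.congr_fun hJ x
  obtain ⟨G, hG⟩ : ∃ G : Module.Dual ℝ T →ₗ[ℝ] T, G = I ∘ₗ wIi := ⟨_, rfl⟩
  have hgG : ∀ y, g (G y) = y := fun y => by
    rw [hG]; exact LinearMap.congr_fun hwIi1 y
  have hg : Function.Injective g := by
    refine (injective_iff_map_eq_zero g).2 fun x hx => ?_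
    by_contra hne
    simpa [hx] using hgpos x hne
  have hGg : ∀ x, G (g x) = x := fun x => hg (hgG (g x))
  have hwI : ∀ y, wIi y = -I (G y) := fun y => by
    simp [hG, hII]
  have hwJ : ∀ y, wJi y = -J (G y) := fun y => by
    have h : J (wJi y) = G y := hg ((LinearMap.congr_fun hwJi1 y).trans (hgG y).symm)
    rw [← h, hJJ, neg_neg]
  have hId := dualMap_eq_of_compatible hII hgG hIg
  have hJd := dualMap_eq_of_compatible hJJ hgG hJg
  have hA : J1 = eB * ((1 / 2 : ℝ) • (blk I (-wIi) (g ∘ₗ I) (-I.dualMap) +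
      blk J wJi (-(g ∘ₗ J)) (-J.dualMap))) * eBi := by
    simp only [J1]
    congr 3
    refine LinearMap.ext fun p => ?_
    simp only [blk_apply, LinearMap.add_apply, LinearMap.neg_apply, LinearMap.sub_apply,
      Prod.mk_add_mk, Prod.mk.injEq]
    constructor <;> abel
  have hB : J2 = eB * ((1 / 2 : ℝ) • (blk I (-wIi) (g ∘ₗ I) (-I.dualMap) -
      blk J wJi (-(g ∘ₗ J)) (-J.dualMap))) * eBi := by
    simp only [J2]
    congr 3
    refine LinearMap.ext fun p => ?_
    simp only [blk_apply, LinearMap.add_apply, LinearMap.neg_apply, LinearMap.sub_apply,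
      Prod.mk_sub_mk, Prod.mk.injEq]
    constructor <;> abel
  have huv : eB * eBi = 1 := blk_unipotent_mul_neg b
  have hvu : eBi * eB = 1 := by
    refine LinearMap.ext fun p => ?_
    simp [eB, eBi, blk_apply]
  have hN : eB * blk 0 0 K 0 * eBi = blk 0 0 K 0 := by
    refine LinearMap.ext fun p => ?_
    simp [eB, eBi, blk_apply]
  have hDD : blk J wJi (-(g ∘ₗ J)) (-J.dualMap) * blk J wJi (-(g ∘ₗ J)) (-J.dualMap) =
      (-2 : ℝ) • blk LinearMap.id (-G) (-g) LinearMap.id := by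
    refine LinearMap.ext fun p => ?_
    simp only [Module.End.mul_apply, blk_apply, LinearMap.smul_apply, LinearMap.neg_apply,
      LinearMap.comp_apply, LinearMap.id_apply, map_add, map_neg, hwJ, hJd, hJJ, hGg,
      Prod.smul_mk, Prod.mk.injEq, hgG]
    constructor <;> module
  have hSS : blk I (-wIi) (g ∘ₗ I) (-I.dualMap) * blk I (-wIi) (g ∘ₗ I) (-I.dualMap) =
      (-2 : ℝ) • blk LinearMap.id G g LinearMap.id := by
    refine LinearMap.ext fun p => ?_
    simp only [Module.End.mul_apply, blk_apply, LinearMap.smul_apply, LinearMap.neg_apply,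
      LinearMap.comp_apply, LinearMap.id_apply, map_add, map_neg, hwI, hId, hII, hGg,
      Prod.smul_mk, Prod.mk.injEq, hgG]
    constructor <;> module
  have hSD : blk I (-wIi) (g ∘ₗ I) (-I.dualMap) * blk J wJi (-(g ∘ₗ J)) (-J.dualMap) = 0 := by
    refine LinearMap.ext fun p => ?_
    simp only [Module.End.mul_apply, blk_apply, LinearMap.zero_apply, LinearMap.neg_apply,
      LinearMap.comp_apply, map_add, map_neg, hwI, hId, hwJ, hJd, hGg, Prod.mk_eq_zero]
    constructor <;> abel
  have hDS : blk J wJi (-(g ∘ₗ J)) (-J.dualMap) * blk I (-wIi) (g ∘ₗ I) (-I.dualMap) = 0 := by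
    refine LinearMap.ext fun p => ?_
    simp only [Module.End.mul_apply, blk_apply, LinearMap.zero_apply, LinearMap.neg_apply,
      LinearMap.comp_apply, map_add, map_neg, hwI, hId, hwJ, hJd, hGg, Prod.mk_eq_zero]
    constructor <;> abel
  have hsq : blk I (-wIi) (g ∘ₗ I) (-I.dualMap) * blk I (-wIi) (g ∘ₗ I) (-I.dualMap) +
      blk J wJi (-(g ∘ₗ J)) (-J.dualMap) * blk J wJi (-(g ∘ₗ J)) (-J.dualMap) =
      (-4 : ℝ) • 1 := by
    rw [hSS, hDD]
    refine LinearMap.ext fun p => Prod.ext ?_ ?_ <;>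
    · simp only [blk_apply, LinearMap.add_apply, LinearMap.smul_apply, LinearMap.neg_apply,
        LinearMap.id_apply, Module.End.one_apply, Prod.smul_mk, Prod.mk_add_mk, Prod.smul_fst,
        Prod.smul_snd]
      module
  have main := commutator_phi_conj_eq_iff (R := Module.End ℝ (T × Module.Dual ℝ T))
    huv hvu hN hSD hDS hsq hA hB
  rw [← blk_one_lower K] at main
  refine main.trans ?_
  rw [hDD]
  simp only [mul_smul_comm, smul_mul_assoc]
  rw [(smul_right_injective _ (by norm_num : (-2 : ℝ) ≠ 0)).eq_iff]
  simp only [blk_mul]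
  rw [blk_inj]
  constructor
  · rintro ⟨-, -, h, -⟩
    refine LinearMap.ext fun x => ?_
    simpa [hJd] using LinearMap.congr_fun h.symm x
  · intro h
    have hKJ : ∀ x, K (J x) = g (J (G (K x))) := fun x => by
      simpa [hJd] using LinearMap.congr_fun h x
    refine ⟨?_, ?_, ?_, ?_⟩ <;> refine LinearMap.ext fun x => ?_ <;>
    simp [LinearMap.comp_apply, -LinearMap.dualMap_apply, hwJ, hJd, hKJ, hGg]
end

section
/- Let g be a metric compatible with complex structures I and J on a vector space T (so ω_I = gI, ω_J = gJ are skew), and K a 2-form with KJ = -J*K. Then the variation J̇ defined by J̇ = ω_J^{-1} ω̇_J ω_J^{-1} g - ω_J^{-1} ġ with ω̇_J = -(1/2)(K(IJ) + (IJ)*K) and ġ = -(1/2)(KI - I*K) equals (1/2)[I,J]g^{-1}K. -/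
/-- If `A` is a complex structure compatible with `g`, then `g⁻¹ A* = -A g⁻¹`. -/
theorem inv_dualMap_of_compatible {R T : Type*} [CommRing R] [AddCommGroup T] [Module R T]
    {g : T →ₗ[R] Module.Dual R T} {gi : Module.Dual R T →ₗ[R] T} {A : Module.End R T}
    (hA : A * A = -1) (hAg : A.dualMap ∘ₗ g ∘ₗ A = g)
    (hgi1 : g ∘ₗ gi = LinearMap.id) (hgi2 : gi ∘ₗ g = LinearMap.id)
    (f : Module.Dual R T) : gi (A.dualMap f) = -A (gi f) := by
  have hAA : A (A (gi f)) = -gi f := LinearMap.congr_fun hA (gi f)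
  have h : A.dualMap (g (A (A (gi f)))) = g (A (gi f)) := LinearMap.congr_fun hAg (A (gi f))
  have hf : g (gi f) = f := LinearMap.congr_fun hgi1 f
  have hgA : gi (g (A (gi f))) = A (gi f) := LinearMap.congr_fun hgi2 (A (gi f))
  rw [hAA, map_neg, map_neg, hf] at h
  rw [← hgA, ← h, map_neg, neg_neg]

/-- The algebraic identity
`ω_J⁻¹ ω̇_J ω_J⁻¹ g - ω_J⁻¹ ġ = (1/2)[I,J]g⁻¹K` with
`ω̇_J = -(1/2){K, IJ}` and `ġ = -(1/2)[K,I]`. -/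
theorem stmt10 (T : Type*) [AddCommGroup T] [Module ℝ T] [FiniteDimensional ℝ T]
    (g K : T →ₗ[ℝ] Module.Dual ℝ T) (I J : Module.End ℝ T)
    (gi wJi : Module.Dual ℝ T →ₗ[ℝ] T)
    (hI : I * I = -1) (hJ : J * J = -1)
    (hgsymm : ∀ x y : T, g x y = g y x)
    (hgpos : ∀ x : T, x ≠ 0 → 0 < g x x)
    (hIg : I.dualMap ∘ₗ g ∘ₗ (I : T →ₗ[ℝ] T) = g)
    (hJg : J.dualMap ∘ₗ g ∘ₗ (J : T →ₗ[ℝ] T) = g)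
    (hKskew : ∀ x y : T, K x y = - K y x)
    (hK11 : K ∘ₗ (J : T →ₗ[ℝ] T) = -(J.dualMap ∘ₗ K))
    (hgi1 : g ∘ₗ gi = LinearMap.id) (hgi2 : gi ∘ₗ g = LinearMap.id)
    (hwJi1 : (g ∘ₗ (J : T →ₗ[ℝ] T)) ∘ₗ wJi = LinearMap.id)
    (hwJi2 : wJi ∘ₗ (g ∘ₗ (J : T →ₗ[ℝ] T)) = LinearMap.id) :
    wJi ∘ₗ ((-(1/2 : ℝ)) • (K ∘ₗ ((I * J : Module.End ℝ T) : T →ₗ[ℝ] T)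
          + ((I * J : Module.End ℝ T) : T →ₗ[ℝ] T).dualMap ∘ₗ K)) ∘ₗ wJi ∘ₗ g
      - wJi ∘ₗ ((-(1/2 : ℝ)) • (K ∘ₗ (I : T →ₗ[ℝ] T) - I.dualMap ∘ₗ K))
      = (1/2 : ℝ) • (((I * J - J * I : Module.End ℝ T) : T →ₗ[ℝ] T) ∘ₗ gi ∘ₗ K) := by
  have hJJ (x : T) : J (J x) = -x := LinearMap.congr_fun hJ x
  have hgiI := inv_dualMap_of_compatible hI hIg hgi1 hgi2
  have hgiJ := inv_dualMap_of_compatible hJ hJg hgi1 hgi2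
  have hw (f : Module.Dual ℝ T) : wJi f = -J (gi f) := by
    have h : gi (g (J (wJi f))) = gi f := congrArg gi (LinearMap.congr_fun hwJi1 f)
    have h' : gi (g (J (wJi f))) = J (wJi f) := LinearMap.congr_fun hgi2 (J (wJi f))
    rw [← h, h', hJJ, neg_neg]
  have hgg (x : T) : gi (g x) = x := LinearMap.congr_fun hgi2 x
  have hKJ (x : T) : K (J x) = -J.dualMap (K x) := LinearMap.congr_fun hK11 x
  have hIJ (f : Module.Dual ℝ T) : (I * J).dualMap f = J.dualMap (I.dualMap f) := rfl
  ext x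
  simp only [LinearMap.sub_apply, LinearMap.comp_apply, LinearMap.smul_apply,
    LinearMap.add_apply, Module.End.mul_apply, hIJ, hw, hgg, map_neg, map_smul, map_add, map_sub,
    hJJ, hKJ, hgiI, hgiJ]
  module
end
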